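/- Let g^{ab} = g^{ba} and γ_a be smooth real functions on ℝⁿ and let ρ be a smooth strictly positive function on ℝⁿ. Define the operator Δ_sing f = (1/2)(g^{ab}∂_a∂_b f + (∂_b g^{ba})∂_a f + ((1/2)∂_a(g^{ab}γ_b) − (1/4)γ_a g^{ab}γ_b)·f) on smooth functions, and set X_a = γ_a + ∂_a log ρ. Then for every smooth function f on ℝⁿ: ρ^{−1/2}·Δ_sing(ρ^{1/2}·f) = (1/(2ρ))∂_a(ρ g^{ab}∂_b f) + ((1/4)(1/ρ)∂_a(ρ g^{ab}X_b) − (1/8)X_a g^{ab}X_b)·f. -/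

import Mathlib

open MeasureTheory Real

/-- Partial derivative of a function on ℝⁿ in the direction of the `a`-th coordinate. -/
noncomputable def pd {n : ℕ} (a : Fin n) (f : (Fin n → ℝ) → ℝ) : (Fin n → ℝ) → ℝ :=
  fun x => fderiv ℝ f x (Pi.single a 1)

open Finset in
/-- Contracting a symmetric array with an antisymmetric one gives zero. -/
lemma sum_mul_antisymm_eq_zero {ι : Type*} [Fintype ι] (g : ι → ι → ℝ)
    (hg : ∀ a b, g a b = g b a) (p q : ι → ℝ) :
    ∑ a, ∑ b, g a b * (p a * q b - p b * q a) = 0 := by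
  have h : ∑ a, ∑ b, g a b * (p a * q b) = ∑ a, ∑ b, g a b * (p b * q a) := by
    rw [sum_comm]
    exact sum_congr rfl fun a _ => sum_congr rfl fun b _ => by rw [hg]
  simp only [mul_sub, sum_sub_distrib, h, sub_self]

section PartialDerivative

variable {n : ℕ} {f h : (Fin n → ℝ) → ℝ} {x : Fin n → ℝ}

lemma pd_add (a : Fin n) (hf : DifferentiableAt ℝ f x) (hh : DifferentiableAt ℝ h x) :
    pd a (fun y => f y + h y) x = pd a f x + pd a h x := by
  simp only [pd, fderiv_fun_add hf hh, add_apply]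

lemma pd_mul (a : Fin n) (hf : DifferentiableAt ℝ f x) (hh : DifferentiableAt ℝ h x) :
    pd a (fun y => f y * h y) x = pd a f x * h x + f x * pd a h x := by
  simp only [pd, fderiv_fun_mul hf hh, add_apply,
    smul_apply, smul_eq_mul]
  ring

lemma pd_const_mul (a : Fin n) (c : ℝ) (hf : DifferentiableAt ℝ f x) :
    pd a (fun y => c * f y) x = c * pd a f x := by
  simp only [pd, fderiv_const_mul hf, smul_apply, smul_eq_mul]

lemma pd_exp (a : Fin n) (hf : DifferentiableAt ℝ f x) :
    pd a (fun y => Real.exp (f y)) x = Real.exp (f x) * pd a f x := by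
  simp only [pd, fderiv_exp hf, smul_apply, smul_eq_mul]

lemma pd_sum {ι : Type*} [Fintype ι] {F : ι → (Fin n → ℝ) → ℝ} (a : Fin n)
    (hF : ∀ i, DifferentiableAt ℝ (F i) x) :
    pd a (fun y => ∑ i, F i y) x = ∑ i, pd a (F i) x := by
  simp only [pd, fderiv_fun_sum fun i _ => hF i, sum_apply]

lemma contDiff_pd (a : Fin n) (hf : ContDiff ℝ (⊤ : ℕ∞) f) :
    ContDiff ℝ (⊤ : ℕ∞) (pd a f) :=
  (hf.fderiv_right (m := (⊤ : ℕ∞)) (by simp)).clm_apply contDiff_const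

lemma pd_sum_mul {g v : Fin n → (Fin n → ℝ) → ℝ} (a : Fin n)
    (hg : ∀ b, DifferentiableAt ℝ (g b) x) (hv : ∀ b, DifferentiableAt ℝ (v b) x) :
    pd a (fun y => ∑ b, g b y * v b y) x
      = ∑ b, (pd a (g b) x * v b x + g b x * pd a (v b) x) := by
  rw [pd_sum a fun b => (hg b).fun_mul (hv b)]
  exact Finset.sum_congr rfl fun b _ => pd_mul a (hg b) (hv b)

lemma pd_exp_mul_sum_mul {u : (Fin n → ℝ) → ℝ} {g v : Fin n → (Fin n → ℝ) → ℝ} (a : Fin n)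
    (hu : DifferentiableAt ℝ u x)
    (hg : ∀ b, DifferentiableAt ℝ (g b) x) (hv : ∀ b, DifferentiableAt ℝ (v b) x) :
    pd a (fun y => Real.exp (u y) * ∑ b, g b y * v b y) x
      = Real.exp (u x) * ∑ b, (pd a u x * (g b x * v b x)
          + (pd a (g b) x * v b x + g b x * pd a (v b) x)) := by
  rw [pd_mul a hu.exp (.fun_sum fun b _ => (hg b).fun_mul (hv b)), pd_exp a hu,
    pd_sum_mul a hg hv, Finset.sum_add_distrib (f := fun b => pd a u x * (g b x * v b x)),
    ← Finset.mul_sum]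
  ring

lemma pd_exp_half_mul {u : (Fin n → ℝ) → ℝ} (a : Fin n)
    (hu : DifferentiableAt ℝ u x) (hf : DifferentiableAt ℝ f x) :
    pd a (fun y => Real.exp (1 / 2 * u y) * f y) x
      = Real.exp (1 / 2 * u x) * (pd a f x + 1 / 2 * (pd a u x * f x)) := by
  rw [pd_mul a (hu.const_mul _).exp hf, pd_exp a (hu.const_mul _), pd_const_mul a _ hu]
  ring

lemma pd_pd_exp_half_mul {u : (Fin n → ℝ) → ℝ} (a b : Fin n)
    (hu : ContDiff ℝ (⊤ : ℕ∞) u) (hf : ContDiff ℝ (⊤ : ℕ∞) f) :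
    pd a (pd b fun y => Real.exp (1 / 2 * u y) * f y) x
      = Real.exp (1 / 2 * u x) * (pd a (pd b f) x + 1 / 2 * (pd a (pd b u) x * f x)
          + 1 / 2 * (pd b u x * pd a f x) + 1 / 2 * (pd a u x * pd b f x)
          + 1 / 4 * (pd a u x * pd b u x * f x)) := by
  have d {h : (Fin n → ℝ) → ℝ} (hh : ContDiff ℝ (⊤ : ℕ∞) h) (y) : DifferentiableAt ℝ h y :=
    hh.differentiable (by simp) y
  have hfb := d (contDiff_pd b hf) x
  have hub := d (contDiff_pd b hu) x
  have hmul := hub.fun_mul (d hf x)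
  rw [show (pd b fun y => Real.exp (1 / 2 * u y) * f y)
      = fun y => Real.exp (1 / 2 * u y) * (pd b f y + 1 / 2 * (pd b u y * f y)) from
      funext fun y => pd_exp_half_mul b (d hu y) (d hf y),
    pd_exp_half_mul a (d hu x) (hfb.fun_add (hmul.const_mul _)),
    pd_add a hfb (hmul.const_mul _), pd_const_mul a _ hmul, pd_mul a hub (d hf x)]
  ring

end PartialDerivative

/-- conjugating the operator `Δ_sing` on half-densities (determined by a
principal symbol `g^{ab}` and a connection `γ_a` on volume forms) by `ρ^{1/2}` produces
the divergence-form Laplacian plus multiplication by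
`(1/4)div_ρ X − (1/8)⟨X,X⟩`, where `X_a = γ_a + ∂_a log ρ`. -/
theorem statement18 (n : ℕ)
    (g : Fin n → Fin n → (Fin n → ℝ) → ℝ) (γ : Fin n → (Fin n → ℝ) → ℝ)
    (ρ : (Fin n → ℝ) → ℝ)
    (hg : ∀ a b, ContDiff ℝ (⊤ : ℕ∞) (g a b)) (hgsymm : ∀ a b, g a b = g b a)
    (hγ : ∀ a, ContDiff ℝ (⊤ : ℕ∞) (γ a)) (hρ : ContDiff ℝ (⊤ : ℕ∞) ρ) (hρpos : ∀ x, 0 < ρ x)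
    (Δsing : ((Fin n → ℝ) → ℝ) → ((Fin n → ℝ) → ℝ))
    (hΔsing : ∀ f x, Δsing f x
      = (1/2) * (∑ a, ∑ b, g a b x * pd a (pd b f) x
          + ∑ a, (∑ b, pd b (g b a) x) * pd a f x
          + ((1/2) * (∑ a, pd a (fun y => ∑ b, g a b y * γ b y) x)
              - (1/4) * ∑ a, ∑ b, γ a x * g a b x * γ b x) * f x))
    (X : Fin n → (Fin n → ℝ) → ℝ)
    (hXdef : ∀ a x, X a x = γ a x + pd a (fun y => Real.log (ρ y)) x) :
    ∀ f : (Fin n → ℝ) → ℝ, ContDiff ℝ (⊤ : ℕ∞) f → ∀ x,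
      ρ x ^ (-(1:ℝ)/2) * Δsing (fun y => ρ y ^ ((1:ℝ)/2) * f y) x
      = (1/(2 * ρ x)) * (∑ a, pd a (fun y => ρ y * ∑ b, g a b y * pd b f y) x)
        + ((1/4) * (1 / ρ x) * (∑ a, pd a (fun y => ρ y * ∑ b, g a b y * X b y) x)
            - (1/8) * ∑ a, ∑ b, X a x * g a b x * X b x) * f x := by
  intro f hf x
  have d {h : (Fin n → ℝ) → ℝ} (hh : ContDiff ℝ (⊤ : ℕ∞) h) : DifferentiableAt ℝ h x :=
    hh.differentiable (by simp) x
  obtain ⟨u, hu⟩ : ∃ u : (Fin n → ℝ) → ℝ, u = fun y => Real.log (ρ y) := ⟨_, rfl⟩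
  have hus : ContDiff ℝ (⊤ : ℕ∞) u := hu ▸ hρ.log fun y => (hρpos y).ne'
  have hρu : ρ = fun y => Real.exp (u y) := by
    funext y
    rw [hu, Real.exp_log (hρpos y)]
  have hX : X = fun a y => γ a y + pd a u y := by
    funext a y
    rw [hXdef, hu]
  have hXs (a) : ContDiff ℝ (⊤ : ℕ∞) (X a) := hX ▸ (hγ a).add (contDiff_pd a hus)
  have hpow (y) (r : ℝ) : ρ y ^ r = Real.exp (r * u y) := by
    rw [hρu, ← Real.exp_mul, mul_comm]
  have hpdX (a b) : pd a (X b) x = pd a (γ b) x + pd a (pd b u) x := by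
    rw [hX]
    exact pd_add a (d (hγ b)) (d (contDiff_pd b hus))
  have hdivγ (a) := pd_sum_mul a (fun b => d (hg a b)) (fun b => d (hγ b))
  have hdivf (a) :=
    pd_exp_mul_sum_mul a (d hus) (fun b => d (hg a b)) (fun b => d (contDiff_pd b hf))
  have hdivX (a) := pd_exp_mul_sum_mul a (d hus) (fun b => d (hg a b)) (fun b => d (hXs b))
  have hfirst (F : (Fin n → ℝ) → ℝ) :
      ∑ a, (∑ b, pd b (g b a) x) * pd a F x = ∑ a, ∑ b, pd a (g a b) x * pd b F x := by
    simp only [Finset.sum_mul]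
    exact Finset.sum_comm
  have hexp : Real.exp (-1 / 2 * u x) = (Real.exp (1 / 2 * u x))⁻¹ := by
    rw [← Real.exp_neg]
    ring_nf
  have hanti (p q : Fin n → ℝ) := sum_mul_antisymm_eq_zero (fun a b => g a b x)
    (fun a b => by rw [hgsymm]) p q
  have hfu := hanti (fun a => pd a f x) (fun a => pd a u x)
  have hγu := hanti (fun a => γ a x) (fun a => pd a u x)
  simp only [hpow, hΔsing, hfirst]
  simp only [hdivγ, pd_pd_exp_half_mul _ _ hus hf,
    pd_exp_half_mul _ (d hus) (d hf)]
  rw [hρu]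
  simp only [hdivf, hdivX, hpdX]
  simp only [hX]
  have hE := (Real.exp_pos (u x)).ne'
  have he := (Real.exp_pos (1 / 2 * u x)).ne'
  rw [hexp, ← sub_eq_zero]
  trans (1 / 4) * ∑ a, ∑ b, g a b x * (pd a f x * pd b u x - pd b f x * pd a u x)
      + (f x / 8) * ∑ a, ∑ b, g a b x * (γ a x * pd b u x - γ b x * pd a u x)
  · simp only [Finset.mul_sum, Finset.sum_mul, ← Finset.sum_add_distrib,
      ← Finset.sum_sub_distrib]
    refine Finset.sum_congr rfl fun a _ => Finset.sum_congr rfl fun b _ => ?_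
    generalize Real.exp (u x) = E at *
    generalize Real.exp (1 / 2 * u x) = e at *
    field_simp
    ring
  · rw [hfu, hγu, mul_zero, mul_zero, add_zero]
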